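/- There does not exist a Hesse Kaleidoscopic difference family HKDF(13) in Z/13Z. -/

import Mathlib

section KaleidoscopeDefs

variable {G V : Type*}

/-- The multiset of differences `x - y` over ordered pairs of distinct elements of `B`. -/
def diffMultiset [AddGroup G] [DecidableEq G] (B : Finset G) : Multiset G :=
  ((B ×ˢ B).filter fun p => p.1 ≠ p.2).val.map fun p => p.1 - p.2

/-- A `(G, k, lam)`-difference family, given as a multiset of blocks. -/
def IsDiffFamily [AddGroup G] [DecidableEq G] (k lam : ℕ) (𝓕 : Multiset (Finset G)) : Prop :=
  (∀ B ∈ 𝓕, B.card = k) ∧ ∀ g : G, g ≠ 0 → (𝓕.bind diffMultiset).count g = lam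

/-- The `j`-th line `{b_j, b_{j+1}, b_{j+3}}` (indices mod 7) of an ordered 7-tuple. -/
def fanoLine [DecidableEq G] (B : Fin 7 → G) (j : Fin 7) : Finset G :=
  {B j, B (j + 1), B (j + 3)}

/-- A Fano Kaleidoscopic difference family: a family of ordered 7-tuples of distinct
elements such that for each `j` the family of `j`-th lines is a `(G,3,1)`-DF. -/
def IsFKDF [AddGroup G] [DecidableEq G] (𝓕 : Multiset (Fin 7 → G)) : Prop :=
  (∀ B ∈ 𝓕, Function.Injective B) ∧
    ∀ j : Fin 7, IsDiffFamily 3 1 (𝓕.map fun B => fanoLine B j)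

/-- The `i`-th line of an ordered 9-tuple `(binf, b_0, …, b_7)`:
`{b_i, b_{i+1}, b_{i+3}}` (indices mod 8) for `0 ≤ i ≤ 7`, and
`{binf, b_{i-8}, b_{i-4}}` for `8 ≤ i ≤ 11`. -/
def hesseLine [DecidableEq G] (binf : G) (b : Fin 8 → G) (i : Fin 12) : Finset G :=
  if h : (i : ℕ) < 8 then
    {b ⟨i, h⟩, b (⟨i, h⟩ + 1), b (⟨i, h⟩ + 3)}
  else
    {binf, b ⟨(i : ℕ) - 8, by have := i.isLt; omega⟩,
      b (⟨(i : ℕ) - 8, by have := i.isLt; omega⟩ + 4)}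

/-- A Hesse Kaleidoscopic difference family: a family of ordered 9-tuples of distinct
elements such that for each `i` the family of `i`-th lines is a `(G,3,1)`-DF. -/
def IsHKDF [AddGroup G] [DecidableEq G] (𝓕 : Multiset (G × (Fin 8 → G))) : Prop :=
  (∀ B ∈ 𝓕, Function.Injective B.2 ∧ ∀ k, B.1 ≠ B.2 k) ∧
    ∀ i : Fin 12, IsDiffFamily 3 1 (𝓕.map fun B => hesseLine B.1 B.2 i)

/-- The point set of a colored plane given by its (colored) lines. -/
def linesPts [DecidableEq V] {n : ℕ} (L : Fin n → Finset V) : Finset V :=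
  Finset.univ.biUnion L

/-- `L` describes a Fano plane with points in `V`, where `L i` is the line colored `c_i`:
7 points, seven 3-element lines, and any two distinct points on exactly one line. -/
def IsColoredFano [DecidableEq V] (L : Fin 7 → Finset V) : Prop :=
  (linesPts L).card = 7 ∧ (∀ i, (L i).card = 3) ∧
    ∀ x y : V, x ∈ linesPts L → y ∈ linesPts L → x ≠ y →
      ∃! i : Fin 7, x ∈ L i ∧ y ∈ L i

/-- A Fano Kaleidoscope on the point set `V`: a multiset of line-colored Fano planes such
that for all distinct `x y` and every color `i` exactly one plane has `x, y` on its
`c_i`-colored line. -/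
def IsFanoKaleidoscope [DecidableEq V] (K : Multiset (Fin 7 → Finset V)) : Prop :=
  (∀ L ∈ K, IsColoredFano L) ∧
    ∀ x y : V, x ≠ y → ∀ i : Fin 7,
      Multiset.countP (fun L => x ∈ L i ∧ y ∈ L i) K = 1

/-- A `G`-regular Fano Kaleidoscope: a Fano Kaleidoscope with point set `G` invariant
(with colors) under all translations. -/
def IsRegularFK (G : Type*) [AddGroup G] [DecidableEq G]
    (K : Multiset (Fin 7 → Finset G)) : Prop :=
  IsFanoKaleidoscope K ∧ ∀ g : G, K.map (fun L => fun i => (L i).image (· + g)) = K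

/-- `L` describes a Hesse plane (an `AG(2,3)`) with points in `V`, where `L i` is the line
colored `c_i`. -/
def IsColoredHesse [DecidableEq V] (L : Fin 12 → Finset V) : Prop :=
  (linesPts L).card = 9 ∧ (∀ i, (L i).card = 3) ∧
    ∀ x y : V, x ∈ linesPts L → y ∈ linesPts L → x ≠ y →
      ∃! i : Fin 12, x ∈ L i ∧ y ∈ L i

/-- A Hesse Kaleidoscope on the point set `V`. -/
def IsHesseKaleidoscope [DecidableEq V] (K : Multiset (Fin 12 → Finset V)) : Prop :=
  (∀ L ∈ K, IsColoredHesse L) ∧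
    ∀ x y : V, x ≠ y → ∀ i : Fin 12,
      Multiset.countP (fun L => x ∈ L i ∧ y ∈ L i) K = 1

/-- A `G`-regular Hesse Kaleidoscope. -/
def IsRegularHK (G : Type*) [AddGroup G] [DecidableEq G]
    (K : Multiset (Fin 12 → Finset G)) : Prop :=
  IsHesseKaleidoscope K ∧ ∀ g : G, K.map (fun L => fun i => (L i).image (· + g)) = K

/-- An `(H, k, 1)`-difference matrix: a `k × |H|` matrix with entries in `H` such that the
difference of any two distinct rows contains each element of `H` exactly once. -/
def IsDiffMatrix (H : Type*) [AddGroup H] [Fintype H] (k : ℕ)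
    (M : Fin k → Fin (Fintype.card H) → H) : Prop :=
  ∀ r s : Fin k, r ≠ s → Function.Bijective fun c => M r c - M s c

/-- A 2-`(v, k, lam)` design (block multiset) on the point set `V`. -/
def Is2Design [DecidableEq V] (k lam : ℕ) (𝓑 : Multiset (Finset V)) : Prop :=
  (∀ b ∈ 𝓑, b.card = k) ∧
    ∀ x y : V, x ≠ y → Multiset.countP (fun b => x ∈ b ∧ y ∈ b) 𝓑 = lam

/-- A pairwise balanced design with block sizes in `K` on the point set `V`. -/
def IsPBD [DecidableEq V] (K : Set ℕ) (𝓑 : Multiset (Finset V)) : Prop :=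
  (∀ b ∈ 𝓑, b.card ∈ K) ∧
    ∀ x y : V, x ≠ y → Multiset.countP (fun b => x ∈ b ∧ y ∈ b) 𝓑 = 1

/-- Existence of a Fano Kaleidoscope of order `v`. -/
def ExistsFK (v : ℕ) : Prop :=
  ∃ K : Multiset (Fin 7 → Finset (Fin v)), IsFanoKaleidoscope K

end KaleidoscopeDefs

/-- Quadratic residue indicator modulo 13 (bit mask of `{1,3,4,9,10,12}`). -/
def q (x : ZMod 13) : Bool := Nat.testBit 5658 x.val

lemma q_neg : ∀ x : ZMod 13, q (-x) = q x := by decide +kernel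

/-- If two difference triples have twelve distinct differences, the first is monochromatic. -/
lemma mono_aux : ∀ p r : ZMod 13,
    [p, -p, r, -r, p + r, -(p + r)].Nodup → ¬ (q p = q r ∧ q (p + r) = q r) →
    ∀ s t : ZMod 13, ¬ [s, -s, t, -t, s + t, -(s + t), p, -p, r, -r, p + r, -(p + r)].Nodup := by
  decide +kernel

set_option synthInstance.maxHeartbeats 0 in
set_option synthInstance.maxSize 100000 in
set_option maxRecDepth 10000 in
/-- No arrangement of the nine points has all twelve lines monochromatic. -/
lemma search :
    ∀ x0 : ZMod 13, (x0 ≠ 0) →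
    ∀ x4 : ZMod 13, (x4 ≠ 0 ∧ x4 ≠ x0 ∧ q x4 = q x0 ∧ q (x4 - x0) = q x0) →
    ∀ x1 : ZMod 13, (x1 ≠ 0 ∧ x1 ≠ x0 ∧ x1 ≠ x4) →
    ∀ x5 : ZMod 13, (x5 ≠ 0 ∧ x5 ≠ x0 ∧ x5 ≠ x4 ∧ x5 ≠ x1 ∧ q x5 = q x1 ∧ q (x5 - x1) = q x1) →
    ∀ x3 : ZMod 13, (x3 ≠ 0 ∧ x3 ≠ x0 ∧ x3 ≠ x4 ∧ x3 ≠ x1 ∧ x3 ≠ x5 ∧ q (x3 - x0) = q (x1 - x0) ∧ q (x3 - x1) = q (x1 - x0)) →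
    ∀ x7 : ZMod 13, (x7 ≠ 0 ∧ x7 ≠ x0 ∧ x7 ≠ x4 ∧ x7 ≠ x1 ∧ x7 ≠ x5 ∧ x7 ≠ x3 ∧ q (x7 - x4) = q (x5 - x4) ∧ q (x7 - x5) = q (x5 - x4) ∧ q x7 = q x3 ∧ q (x7 - x3) = q x3) →
    ∀ x2 : ZMod 13, (x2 ≠ 0 ∧ x2 ≠ x0 ∧ x2 ≠ x4 ∧ x2 ≠ x1 ∧ x2 ≠ x5 ∧ x2 ≠ x3 ∧ x2 ≠ x7 ∧ q (x2 - x4) = q (x1 - x4) ∧ q (x2 - x1) = q (x1 - x4) ∧ q (x2 - x5) = q (x3 - x5) ∧ q (x2 - x3) = q (x3 - x5) ∧ q (x2 - x0) = q (x7 - x0) ∧ q (x2 - x7) = q (x7 - x0)) →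
    ∀ x6 : ZMod 13, (x6 ≠ 0 ∧ x6 ≠ x0 ∧ x6 ≠ x4 ∧ x6 ≠ x1 ∧ x6 ≠ x5 ∧ x6 ≠ x3 ∧ x6 ≠ x7 ∧ x6 ≠ x2 ∧ q (x6 - x4) = q (x3 - x4) ∧ q (x6 - x3) = q (x3 - x4) ∧ q (x6 - x0) = q (x5 - x0) ∧ q (x6 - x5) = q (x5 - x0) ∧ q (x6 - x1) = q (x7 - x1) ∧ q (x6 - x7) = q (x7 - x1) ∧ q x6 = q x2 ∧ q (x6 - x2) = q x2) →
    False := by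
  decide +kernel

lemma diff_triple {a b c : ZMod 13} (hab : a ≠ b) (hac : a ≠ c) (hbc : b ≠ c) :
    diffMultiset {a, b, c} =
      (↑[a - b, -(a - b), b - c, -(b - c), (a - b) + (b - c), -((a - b) + (b - c))] :
        Multiset (ZMod 13)) := by
  have h : ((({a, b, c} : Finset (ZMod 13)) ×ˢ {a, b, c}).filter fun p => p.1 ≠ p.2) =
      {(a, b), (b, a), (b, c), (c, b), (a, c), (c, a)} := by
    ext ⟨x, y⟩
    simp only [Finset.mem_filter, Finset.mem_product, Finset.mem_insert, Finset.mem_singleton,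
      Prod.mk.injEq]
    grind
  unfold diffMultiset
  rw [h]
  have e : ({(a, b), (b, a), (b, c), (c, b), (a, c), (c, a)} : Finset (ZMod 13 × ZMod 13)).val =
      (↑[(a, b), (b, a), (b, c), (c, b), (a, c), (c, a)] : Multiset (ZMod 13 × ZMod 13)) := by
    have nd : [(a, b), (b, a), (b, c), (c, b), (a, c), (c, a)].Nodup := by
      simp only [List.nodup_cons, List.mem_cons, Prod.mk.injEq, List.not_mem_nil]
      grind
    have : ({(a, b), (b, a), (b, c), (c, b), (a, c), (c, a)} : Finset (ZMod 13 × ZMod 13)) =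
      ⟨(↑[(a, b), (b, a), (b, c), (c, b), (a, c), (c, a)] : Multiset _), Multiset.coe_nodup.mpr nd⟩ := by
      ext z; simp
    rw [this]
  rw [e]
  simp

lemma zero_notMem_diff (T : Finset (ZMod 13)) : (0 : ZMod 13) ∉ diffMultiset T := by
  unfold diffMultiset
  simp only [Multiset.mem_map, Finset.mem_val, Finset.mem_filter, not_exists, not_and]
  rintro ⟨x, y⟩ ⟨_, h⟩ h2
  exact h (sub_eq_zero.mp h2)

lemma df_nodup {M : Multiset (Finset (ZMod 13))} (h : IsDiffFamily 3 1 M) :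
    (M.bind diffMultiset).Nodup := by
  rw [Multiset.nodup_iff_count_le_one]
  intro g
  by_cases hg : g = 0
  · subst hg
    rw [Multiset.count_eq_zero_of_notMem]
    · exact Nat.zero_le _
    · simp only [Multiset.mem_bind, not_exists, not_and]
      intro T _
      exact zero_notMem_diff T
  · exact (h.2 g hg).le

lemma card3 {T : Finset (ZMod 13)} (h : T.card = 3) : ∃ a b c : ZMod 13,
    a ≠ b ∧ a ≠ c ∧ b ≠ c ∧ T = {a, b, c} := Finset.card_eq_three.mp h

lemma df_second {T : Finset (ZMod 13)} {M : Multiset (Finset (ZMod 13))}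
    (h : IsDiffFamily 3 1 (T ::ₘ M)) : ∃ U, U ∈ M := by
  by_contra hM
  have hM0 : M = 0 := Multiset.eq_zero_of_forall_notMem fun U hU => hM ⟨U, hU⟩
  subst hM0
  obtain ⟨a, b, c, hab, hac, hbc, rfl⟩ := card3 (h.1 T (by simp))
  have hsub : (Finset.univ.erase (0 : ZMod 13)) ⊆ (diffMultiset {a, b, c}).toFinset := by
    intro g hg
    have := h.2 g (Finset.ne_of_mem_erase hg)
    rw [Multiset.mem_toFinset, ← Multiset.count_pos]
    simp only [Multiset.cons_bind, Multiset.zero_bind, add_zero] at this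
    omega
  have h1 := Finset.card_le_card hsub
  have h2 := Multiset.toFinset_card_le (diffMultiset {a, b, c})
  rw [diff_triple hab hac hbc] at h1 h2
  have h3 : (Finset.univ.erase (0 : ZMod 13)).card = 12 := by decide
  simp only [Multiset.coe_card, List.length_cons, List.length_nil] at h2
  omega

lemma df_mono {a b c : ZMod 13} {M : Multiset (Finset (ZMod 13))}
    (hab : a ≠ b) (hac : a ≠ c) (hbc : b ≠ c)
    (h : IsDiffFamily 3 1 (({a, b, c} : Finset (ZMod 13)) ::ₘ M)) :
    q (a - b) = q (b - c) ∧ q (a - c) = q (b - c) := by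
  obtain ⟨U, hU⟩ := df_second h
  obtain ⟨N, rfl⟩ := Multiset.exists_cons_of_mem hU
  have nd := df_nodup h
  obtain ⟨d, e, f, hde, hdf, hef, rfl⟩ := card3 (h.1 U (by simp))
  rw [Multiset.cons_bind, Multiset.cons_bind, ← add_assoc, diff_triple hab hac hbc,
    diff_triple hde hdf hef] at nd
  have nd2 := (Multiset.nodup_add.mp nd).1
  have nd1 := (Multiset.nodup_add.mp nd2).1
  rw [add_comm, Multiset.coe_add, Multiset.coe_nodup] at nd2
  rw [Multiset.coe_nodup] at nd1
  by_contra hc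
  have e1 : a - c = (a - b) + (b - c) := by ring
  rw [e1] at hc
  exact mono_aux _ _ nd1 hc _ _ nd2

/-- there is no Hesse Kaleidoscopic difference family in `ℤ/13ℤ`. -/
theorem no_HKDF13 : ¬ ∃ 𝓕 : Multiset (ZMod 13 × (Fin 8 → ZMod 13)), IsHKDF 𝓕 := by
  rintro ⟨F, hF, hl⟩
  have hne : ∃ B, B ∈ F := by
    by_contra hM
    have hM0 : F = 0 := Multiset.eq_zero_of_forall_notMem fun U hU => hM ⟨U, hU⟩
    subst hM0
    have := (hl 0).2 1 (by decide)
    simp at this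
  obtain ⟨⟨z, b⟩, hB⟩ := hne
  obtain ⟨R, rfl⟩ := Multiset.exists_cons_of_mem hB
  obtain ⟨inj, hz⟩ := hF _ hB
  simp only at inj hz
  have hn : ∀ i j : Fin 8, i ≠ j → b i ≠ b j := fun i j hij h => hij (inj h)
  have key : ∀ i j k : Fin 8, ∀ l : Fin 12, hesseLine z b l = {b i, b j, b k} →
      i ≠ j → i ≠ k → j ≠ k →
      q (b i - b j) = q (b j - b k) ∧ q (b i - b k) = q (b j - b k) := by
    intro i j k l e h1 h2 h3
    have := hl l
    rw [Multiset.map_cons, e] at this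
    exact df_mono (hn _ _ h1) (hn _ _ h2) (hn _ _ h3) this
  have keyz : ∀ j k : Fin 8, ∀ l : Fin 12, hesseLine z b l = {z, b j, b k} → j ≠ k →
      q (z - b j) = q (b j - b k) ∧ q (z - b k) = q (b j - b k) := by
    intro j k l e h3
    have := hl l
    rw [Multiset.map_cons, e] at this
    exact df_mono (hz _) (hz _) (hn _ _ h3) this
  have k0 := key 0 1 3 0 rfl (by decide) (by decide) (by decide)
  have k1 := key 1 2 4 1 rfl (by decide) (by decide) (by decide)
  have k2 := key 2 3 5 2 rfl (by decide) (by decide) (by decide)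
  have k3 := key 3 4 6 3 rfl (by decide) (by decide) (by decide)
  have k4 := key 4 5 7 4 rfl (by decide) (by decide) (by decide)
  have k5 := key 5 6 0 5 rfl (by decide) (by decide) (by decide)
  have k6 := key 6 7 1 6 rfl (by decide) (by decide) (by decide)
  have k7 := key 7 0 2 7 rfl (by decide) (by decide) (by decide)
  have k8 := keyz 0 4 8 rfl (by decide)
  have k9 := keyz 1 5 9 rfl (by decide)
  have k10 := keyz 2 6 10 rfl (by decide)
  have k11 := keyz 3 7 11 rfl (by decide)
  have qs : ∀ x y : ZMod 13, q (x - y) = q (y - x) := fun x y => by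
    rw [← q_neg (y - x), neg_sub]
  have ss : ∀ x y : ZMod 13, (x - z) - (y - z) = x - y := fun x y => by ring
  have hz' : ∀ k, b k - z ≠ 0 := fun k h => hz k (sub_eq_zero.mp h).symm
  have hn' : ∀ i j : Fin 8, i ≠ j → b i - z ≠ b j - z := fun i j h e =>
    hn i j h (sub_left_injective e)
  refine search
    (b 0 - z) (hz' _)
    (b 4 - z) ⟨hz' _, hn' _ _ (by decide), ?_, ?_⟩
    (b 1 - z) ⟨hz' _, hn' _ _ (by decide), hn' _ _ (by decide)⟩
    (b 5 - z) ⟨hz' _, hn' _ _ (by decide), hn' _ _ (by decide), hn' _ _ (by decide), ?_, ?_⟩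
    (b 3 - z) ⟨hz' _, hn' _ _ (by decide), hn' _ _ (by decide), hn' _ _ (by decide), hn' _ _ (by decide), ?_, ?_⟩
    (b 7 - z) ⟨hz' _, hn' _ _ (by decide), hn' _ _ (by decide), hn' _ _ (by decide), hn' _ _ (by decide), hn' _ _ (by decide), ?_, ?_, ?_, ?_⟩
    (b 2 - z) ⟨hz' _, hn' _ _ (by decide), hn' _ _ (by decide), hn' _ _ (by decide), hn' _ _ (by decide), hn' _ _ (by decide), hn' _ _ (by decide), ?_, ?_, ?_, ?_, ?_, ?_⟩
    (b 6 - z) ⟨hz' _, hn' _ _ (by decide), hn' _ _ (by decide), hn' _ _ (by decide), hn' _ _ (by decide), hn' _ _ (by decide), hn' _ _ (by decide), hn' _ _ (by decide), ?_, ?_, ?_, ?_, ?_, ?_, ?_, ?_⟩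
  all_goals try simp only [ss]
  all_goals grind
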